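/- There exist ε > 0 and δ ∈ (0,1) such that for every β ∈ (2, 5/2], every ν > 0, every t₀ ≥ 0, and every weak solution X = (X_n)_{n≥1} of the viscous dyadic model on [t₀,∞) with X_n(t) ≥ 0 for all n and t, with square-summable initial condition, and with K₀ := sup_{n≥1} (λ_n^{β-2+ε} X_n(t₀)) < ∞, one has sup_{t≥t₀} sup_{n≥1} (λ_n^{β-2+ε} X_n(t)) ≤ K₀/δ. -/

import Mathlib

/-- The dyadic frequencies: `λ_0 = 0`, `λ_n = 2^n` for `n ≥ 1`. -/
noncomputable def lam (n : ℕ) : ℝ := if n = 0 then 0 else 2 ^ n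

/-- `X` is a weak solution of the viscous dyadic model with parameter `β` and
viscosity `ν` on the interval `I`. -/
def IsViscousSolution (β ν : ℝ) (I : Set ℝ) (X : ℕ → ℝ → ℝ) : Prop :=
  ∀ n, 1 ≤ n → ∀ t ∈ I, HasDerivWithinAt (X n)
    (-ν * lam n ^ 2 * X n t + lam (n - 1) ^ β * (X (n - 1) t) ^ 2
      - lam n ^ β * X n t * X (n + 1) t) I t

open Set Filter Topology

/-- The projection of `ι → ℝ` onto the unit cube. -/
noncomputable def cubeProj {ι : Type*} (v : ι → ℝ) : ι → ℝ := fun i => max 0 (min 1 (v i))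

lemma cubeProj_mem {ι : Type*} (v : ι → ℝ) : cubeProj v ∈ Icc (0 : ι → ℝ) 1 :=
  ⟨fun _ => le_max_left _ _, fun _ => max_le zero_le_one (min_le_left _ _)⟩

lemma cubeProj_lipschitz {ι : Type*} [Fintype ι] :
    LipschitzWith 1 (cubeProj : (ι → ℝ) → ι → ℝ) := by
  refine LipschitzWith.of_dist_le_mul fun v w => ?_
  rw [NNReal.coe_one, one_mul, dist_pi_le_iff dist_nonneg]
  refine fun i => le_trans ?_ (dist_le_pi_dist v w i)
  simp only [cubeProj, Real.dist_eq]
  rw [max_comm 0, max_comm 0]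
  exact (abs_max_sub_max_le_abs _ _ _).trans (by
    simpa using abs_min_sub_min_le_max (1 : ℝ) (v i) 1 (w i))

/-- A `C¹` vector field, precomposed with the projection onto the unit cube, is bounded and
Lipschitz, hence has solutions on every bounded time interval. -/
lemma exists_solution_cubeProj {ι : Type*} [Fintype ι] {F : (ι → ℝ) → ι → ℝ}
    (hF : ContDiff ℝ 1 F) (x₀ : ι → ℝ) {a b : ℝ} (hab : a ≤ b) :
    ∃ α : ℝ → ι → ℝ, α a = x₀ ∧
      ∀ t ∈ Icc a b, HasDerivWithinAt α (F (cubeProj (α t))) (Icc a b) t := by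
  obtain ⟨K, hK⟩ := LocallyLipschitzOn.exists_lipschitzOnWith_of_compact
    (isCompact_Icc (a := (0 : ι → ℝ)) (b := 1)) (hF.locallyLipschitz.locallyLipschitzOn)
  obtain ⟨C, hC⟩ := (isCompact_Icc (a := (0 : ι → ℝ)) (b := 1)).exists_bound_of_continuousOn
    hF.continuous.continuousOn
  have hC0 : 0 ≤ C := (norm_nonneg _).trans (hC _ (cubeProj_mem x₀))
  have hpl : IsPicardLindelof (fun _ x => F (cubeProj x)) (⟨a, left_mem_Icc.2 hab⟩ : Icc a b) x₀
      (⟨C, hC0⟩ * ⟨b - a, sub_nonneg.2 hab⟩) 0 ⟨C, hC0⟩ K :=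
    { lipschitzOnWith := fun t _ => by
        have := hK.comp (cubeProj_lipschitz.lipschitzOnWith (s := univ))
          (fun v _ => cubeProj_mem v)
        rw [mul_one] at this
        exact this.mono (subset_univ _)
      continuousOn := fun x _ => continuousOn_const
      norm_le := fun t _ x _ => hC _ (cubeProj_mem x)
      mul_max_le := by
        simp only [sub_self, NNReal.coe_zero, sub_zero]
        rw [max_eq_left (sub_nonneg.2 hab)]
        exact le_rfl }
  exact hpl.exists_eq_forall_mem_Icc_hasDerivWithinAt₀

lemma upper_poly {x : ℝ} (h0 : 0 ≤ x) (h1 : x ≤ 2 / 3) :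
    x ^ 2 + x * (2 / 3 + x / 2) / 2
      ≤ (2 / 3 + x / 2) * (16 * (2 / 3 + x / 2) ^ 4 - 1) / 15 := by
  nlinarith [mul_nonneg h0 (sub_nonneg.2 h1), pow_nonneg h0 2, pow_nonneg h0 3,
    pow_nonneg h0 4, pow_nonneg h0 5, sq_nonneg (x - 1 / 3), sq_nonneg (x - 1 / 2)]

lemma lower_poly {x : ℝ} (h0 : 1 / 2 ≤ x) (h1 : x ≤ 1) :
    (103 / 200) * (64 / 15 * x ^ 3) * (1 - x * ((16 * x ^ 4 - 1) / 15)) ≤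
      (99 / 25) * (x ^ 2 - (16 * x ^ 4 - 1) / 15
        * (2 / 3 + (103 / 400) * ((16 * x ^ 4 - 1) / 15))) := by
  have h : ∀ i j : ℕ, 0 ≤ (x - 1 / 2) ^ i * (1 - x) ^ j := fun i j =>
    mul_nonneg (pow_nonneg (sub_nonneg.2 h0) i) (pow_nonneg (sub_nonneg.2 h1) j)
  linarith [h 0 8, h 1 7, h 2 6, h 3 5, h 4 4, h 5 3, h 6 2, h 7 1, h 8 0]

lemma hasDerivWithinAt_Ici_of_Icc {f : ℝ → ℝ} {f' a b t : ℝ} (ht : t ∈ Ico a b)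
    (hf : HasDerivWithinAt f f' (Icc a b) t) : HasDerivWithinAt f f' (Ici t) t :=
  hf.mono_of_mem_nhdsWithin
    (mem_of_superset (Icc_mem_nhdsGE ht.2) (Icc_subset_Icc_left ht.1))

lemma nonneg_of_deriv_nonneg_of_neg {f f' : ℝ → ℝ} {a b : ℝ}
    (hf : ∀ t ∈ Icc a b, HasDerivWithinAt f (f' t) (Icc a b) t) (ha : 0 ≤ f a)
    (hf' : ∀ t ∈ Icc a b, f t < 0 → 0 ≤ f' t) : ∀ t ∈ Icc a b, 0 ≤ f t := by
  intro t ht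
  have key : ∀ η : ℝ, 0 < η → -f t ≤ η * (1 + (t - a)) := by
    intro η hη
    refine image_le_of_deriv_right_lt_deriv_boundary' (f := fun s => -f s) (f' := fun s => -f' s)
      (B := fun s => η * (1 + (s - a))) (B' := fun _ => η) (a := a) (b := b) ?_ ?_ ?_ ?_ ?_ ?_ ht
    · exact fun s hs => (hf s hs).continuousWithinAt.neg
    · exact fun s hs => (hasDerivWithinAt_Ici_of_Icc hs (hf s (Ico_subset_Icc_self hs))).neg
    · simp only [sub_self, add_zero, mul_one]; linarith
    · fun_prop
    · intro s _
      simpa using ((((hasDerivAt_id s).sub_const a).const_add 1).const_mul η).hasDerivWithinAt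
    · intro s hs h
      have : 0 < η * (1 + (s - a)) := mul_pos hη (by linarith [hs.1])
      linarith [hf' s (Ico_subset_Icc_self hs) (by linarith)]
  have hpos : 0 < 1 + (t - a) := by linarith [ht.1]
  by_contra! h
  have := key (-f t / (2 * (1 + (t - a)))) (by apply div_pos <;> linarith)
  have h2 : -f t / (2 * (1 + (t - a))) * (1 + (t - a)) = -f t / 2 := by field_simp
  linarith

/-- A finite system of constraints `f i ≤ 0` is preserved if each of them is strictly restored
whenever it is saturated while all the others hold. -/
lemma forall_nonpos_of_deriv_neg {ι : Type*} [Finite ι] {f f' : ι → ℝ → ℝ} {a b : ℝ}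
    (hf : ∀ i, ∀ t ∈ Icc a b, HasDerivWithinAt (f i) (f' i t) (Icc a b) t)
    (ha : ∀ i, f i a ≤ 0)
    (hneg : ∀ t ∈ Icc a b, (∀ i, f i t ≤ 0) → ∀ i, f i t = 0 → f' i t < 0) :
    ∀ t ∈ Icc a b, ∀ i, f i t ≤ 0 := by
  suffices h : Icc a b ⊆ {t | ∀ i, f i t ≤ 0} from fun t ht => h ht
  refine IsClosed.Icc_subset_of_forall_mem_nhdsWithin ?_ ha ?_
  · have : {t | ∀ i, f i t ≤ 0} ∩ Icc a b = Icc a b ∩ ⋂ i, {t ∈ Icc a b | f i t ≤ 0} := by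
      ext t
      simp only [mem_inter_iff, mem_ofPred_eq, mem_iInter]
      exact ⟨fun h => ⟨h.2, fun i => ⟨h.2, h.1 i⟩⟩, fun h => ⟨fun i => (h.2 i).2, h.1⟩⟩
    rw [this]
    exact isClosed_Icc.inter (isClosed_iInter fun i => isClosed_Icc.isClosed_le
      (fun t ht => (hf i t ht).continuousWithinAt) continuousOn_const)
  · rintro t ⟨htS, ht⟩
    refine eventually_all.2 fun i => ?_
    have hd : HasDerivWithinAt (f i) (f' i t) (Ioi t) t :=
      (hasDerivWithinAt_Ici_of_Icc ht (hf i t (Ico_subset_Icc_self ht))).mono Ioi_subset_Ici_self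
    rcases (htS i).lt_or_eq with h | h
    · exact (hd.continuousWithinAt.eventually (gt_mem_nhds h)).mono fun s hs => le_of_lt hs
    · have hs := (hasDerivWithinAt_iff_tendsto_slope' self_notMem_Ioi).1 hd
      filter_upwards [hs.eventually (gt_mem_nhds (hneg t (Ico_subset_Icc_self ht) htS i h)),
        self_mem_nhdsWithin] with s hs hst
      rw [slope_def_field, h, sub_zero, div_lt_iff₀ (sub_pos.2 hst), zero_mul] at hs
      exact hs.le

lemma upper_boundary {A B c L p x y z : ℝ} (hA : 0 < A) (hB : 0 < B) (hc : 0 < c)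
    (hL : 0 < L) (hLc : 1 ≤ L * c) (hx : 0 ≤ x) (hy : y = 2 / 3 + x / 2) (hy1 : y ≤ 1)
    (hz : c * (16 * y ^ 4 - 1) / 15 ≤ z) :
    -(4 * A) * y + L * B * (c * x ^ 2 - y * z) < (-A * x + B * (c * p ^ 2 - x * y)) / 2 := by
  have hpoly := upper_poly hx (by linarith)
  rw [← hy] at hpoly
  have hy0 : 0 < y := by linarith
  have h1 : L * y * (c * (16 * y ^ 4 - 1) / 15) ≤ L * y * z :=
    mul_le_mul_of_nonneg_left hz (by positivity)
  have h2 : 0 ≤ (L * c - 1) * (y * (16 * y ^ 4 - 1) / 15 - x ^ 2) :=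
    mul_nonneg (by linarith) (by nlinarith [mul_nonneg hx hy0.le])
  have h3 : 0 ≤ B * ((c * p ^ 2 - x * y) / 2 - L * (c * x ^ 2 - y * z)) :=
    mul_nonneg hB.le (by nlinarith [mul_nonneg hc.le (sq_nonneg p)])
  nlinarith [mul_pos hA hy0]

lemma lower_boundary {A B c L p x y z : ℝ} (hA : 0 < A) (hB : 0 < B) (hc : 0 < c)
    (hc' : c ≤ 103 / 200) (hL : 99 / 25 ≤ L) (hx : 0 ≤ x) (hx1 : x ≤ 1)
    (hy : y = c * (16 * x ^ 4 - 1) / 15) (hy0 : 0 ≤ y) (hp : 0 ≤ p) (hp1 : p ≤ 1)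
    (hz : z ≤ 2 / 3 + y / 2) :
    c * (64 / 15 * x ^ 3) * (-A * x + B * (c * p ^ 2 - x * y)) <
      -(4 * A) * y + L * B * (c * x ^ 2 - y * z) := by
  set H := (16 * x ^ 4 - 1) / 15 with hH
  have hyH : y = c * H := by rw [hy, hH]; ring
  have hH0 : 0 ≤ H := nonneg_of_mul_nonneg_right (hyH ▸ hy0) hc
  have hxh : 1 / 2 ≤ x := by
    by_contra! h
    have : x ^ 4 < (1 / 2) ^ 4 := pow_lt_pow_left₀ h hx (by norm_num)
    linarith
  have hH1 : H ≤ 1 := by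
    have : x ^ 4 ≤ 1 := pow_le_one₀ hx hx1
    linarith
  have hpoly := lower_poly hxh hx1
  rw [← hH] at hpoly
  have hp2 : p ^ 2 ≤ 1 := pow_le_one₀ hp hp1
  have hxH : x * H ≤ 1 := mul_le_one₀ hx1 hH0 hH1
  have h1 : c * (64 / 15 * x ^ 3) * (1 - x * H)
      ≤ 103 / 200 * (64 / 15 * x ^ 3) * (1 - x * H) := by
    have := sub_nonneg.2 hxH
    gcongr
  have h2 : H * (2 / 3 + c * H / 2) ≤ H * (2 / 3 + 103 / 400 * H) := by
    refine mul_le_mul_of_nonneg_left ?_ hH0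
    nlinarith
  have h3 : 0 ≤ x ^ 2 - H * (2 / 3 + 103 / 400 * H) := by
    have : 0 ≤ 103 / 200 * (64 / 15 * x ^ 3) * (1 - x * H) :=
      mul_nonneg (by positivity) (sub_nonneg.2 hxH)
    linarith
  have h4 : c * (64 / 15 * x ^ 3) * (1 - x * H) ≤ L * (x ^ 2 - H * (2 / 3 + c * H / 2)) :=
    calc _ ≤ 99 / 25 * (x ^ 2 - H * (2 / 3 + 103 / 400 * H)) := h1.trans hpoly
      _ ≤ L * (x ^ 2 - H * (2 / 3 + 103 / 400 * H)) := mul_le_mul_of_nonneg_right hL h3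
      _ ≤ _ := mul_le_mul_of_nonneg_left (by linarith) (by linarith)
  have h5 : c * (64 / 15 * x ^ 3) * (c * p ^ 2 - x * y) ≤ L * (c * x ^ 2 - y * z) := by
    have e1 : c * (64 / 15 * x ^ 3) * (c * p ^ 2 - x * y)
        ≤ c * (64 / 15 * x ^ 3) * (c * 1 - x * y) := by
      gcongr
    have e2 : L * (c * x ^ 2 - y * (2 / 3 + y / 2)) ≤ L * (c * x ^ 2 - y * z) := by
      have : 0 ≤ L := by linarith
      gcongr
    have e3 := mul_le_mul_of_nonneg_left h4 hc.le
    rw [hyH] at e1 e2 ⊢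
    linarith
  have h6 := mul_le_mul_of_nonneg_left h5 hB.le
  have h7 : -(4 * A) * y = c * (64 / 15 * x ^ 3) * (-A * x) + 4 / 15 * (A * c) := by
    rw [hy]; ring
  rw [h7]
  have := mul_pos hA hc
  linarith

/-- The right-hand side of the equation for the component `n + 1` of the dyadic model after
rescaling. -/
def scaledField (A B c L : ℝ) (v : ℕ → ℝ) (n : ℕ) : ℝ :=
  -(A * 4 ^ n) * v (n + 1) + B * L ^ n * (c * v n ^ 2 - v (n + 1) * v (n + 2))

/-- Extension of a vector of `N` components (numbered from `1`) by `0` on the left and by the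
constant `3 / 5` on the right. -/
noncomputable def galerkinExt {N : ℕ} (v : Fin N → ℝ) : ℕ → ℝ
  | 0 => 0
  | n + 1 => if h : n < N then v ⟨n, h⟩ else 3 / 5

lemma galerkinExt_succ_of_lt {N n : ℕ} (v : Fin N → ℝ) (h : n < N) :
    galerkinExt v (n + 1) = v ⟨n, h⟩ := by
  simp [galerkinExt, h]

lemma galerkinExt_succ_of_le {N n : ℕ} (v : Fin N → ℝ) (h : N ≤ n) :
    galerkinExt v (n + 1) = 3 / 5 := by
  simp [galerkinExt, h]

lemma galerkinExt_cubeProj {N : ℕ} (v : Fin N → ℝ) (k : ℕ) :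
    galerkinExt (cubeProj v) k = max 0 (min 1 (galerkinExt v k)) := by
  cases k with
  | zero => simp [galerkinExt]
  | succ n =>
    by_cases h : n < N
    · simp [galerkinExt, h, cubeProj]
    · simp only [galerkinExt, h, dite_false]
      norm_num

lemma contDiff_galerkinExt {N : ℕ} (k : ℕ) :
    ContDiff ℝ 1 (fun v : Fin N → ℝ => galerkinExt v k) := by
  cases k with
  | zero => exact contDiff_const
  | succ n =>
    by_cases h : n < N
    · simp only [galerkinExt, h, dite_true]
      exact contDiff_apply ℝ ℝ _
    · simp only [galerkinExt, h, dite_false]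
      exact contDiff_const

lemma contDiff_scaledField_galerkinExt {N : ℕ} (A B c L : ℝ) :
    ContDiff ℝ 1 (fun (v : Fin N → ℝ) (i : Fin N) => scaledField A B c L (galerkinExt v) i) := by
  refine contDiff_pi.2 fun i => ?_
  have h := fun k => contDiff_galerkinExt (N := N) k
  unfold scaledField
  exact (contDiff_const.mul (h _)).add (contDiff_const.mul
    ((contDiff_const.mul ((h _).pow 2)).sub ((h _).mul (h _))))

/-- Finite-dimensional approximations of the rescaled model stay in the unit cube. -/
lemma exists_galerkin {A B c L : ℝ} (hA : 0 < A) (hB : 0 < B) (hc : 0 < c)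
    (hc' : c ≤ 103 / 200) (hL : 99 / 25 ≤ L) (hLc : 1 ≤ L * c) (N : ℕ) {v₀ : ℕ → ℝ}
    (h0 : ∀ n, 0 ≤ v₀ n) (h1 : ∀ n, v₀ n ≤ 1 / 2) {a b : ℝ} (hab : a ≤ b) :
    ∃ Y : ℕ → ℝ → ℝ, (∀ t, Y 0 t = 0) ∧ (∀ n < N, Y (n + 1) a = v₀ (n + 1)) ∧
      (∀ t ∈ Icc a b, ∀ n, 0 ≤ Y n t ∧ Y n t ≤ 1) ∧
      ∀ n < N, ∀ t ∈ Icc a b,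
        HasDerivWithinAt (Y (n + 1)) (scaledField A B c L (fun k => Y k t) n) (Icc a b) t := by
  obtain ⟨α, hα, hd⟩ := exists_solution_cubeProj
    (contDiff_scaledField_galerkinExt (N := N) A B c L) (fun i => v₀ (i + 1)) hab
  set Y : ℕ → ℝ → ℝ := fun k t => galerkinExt (α t) k with hY
  have hL0 : 0 < L := by linarith
  have hYlt : ∀ n (h : n < N), Y (n + 1) = fun t => α t ⟨n, h⟩ := fun n h =>
    funext fun t => galerkinExt_succ_of_lt _ h
  have hYge : ∀ n, N ≤ n → Y (n + 1) = fun _ => 3 / 5 := fun n h =>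
    funext fun t => galerkinExt_succ_of_le _ h
  have hY0 : ∀ t, Y 0 t = 0 := fun _ => rfl
  have hYa : ∀ n < N, Y (n + 1) a = v₀ (n + 1) := fun n h => by simp only [hYlt n h, hα]
  have hder : ∀ n < N, ∀ t ∈ Icc a b, HasDerivWithinAt (Y (n + 1))
      (scaledField A B c L (fun k => max 0 (min 1 (Y k t))) n) (Icc a b) t := by
    intro n h t ht
    have := hasDerivWithinAt_pi.1 (hd t ht) ⟨n, h⟩
    rw [hYlt n h]
    simpa only [hY, funext (galerkinExt_cubeProj (α t))] using this
  have hnn : ∀ t ∈ Icc a b, ∀ n, 0 ≤ Y n t := by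
    intro t ht n
    rcases n with _ | n
    · exact le_rfl
    rcases lt_or_ge n N with h | h
    · refine nonneg_of_deriv_nonneg_of_neg (hder n h) (by rw [hYa n h]; exact h0 _) ?_ t ht
      intro s _ hs
      have : max 0 (min 1 (Y (n + 1) s)) = 0 := by
        rw [max_eq_left]; exact (min_le_right _ _).trans hs.le
      simp only [scaledField, this]
      simp only [mul_zero, zero_mul, sub_zero, zero_add]
      positivity
    · rw [hYge n h]; norm_num
  let Y' : ℕ → ℝ → ℝ := fun n t =>
    if n < N then scaledField A B c L (fun k => max 0 (min 1 (Y k t))) n else 0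
  have hder' : ∀ n, ∀ t ∈ Icc a b, HasDerivWithinAt (Y (n + 1)) (Y' n t) (Icc a b) t := by
    intro n t ht
    by_cases h : n < N
    · simpa only [Y', h, if_true] using hder n h t ht
    · rw [hYge n (not_lt.1 h)]
      simpa only [Y', h, if_false] using hasDerivWithinAt_const t (Icc a b) (3 / 5 : ℝ)
  let f : Fin N ⊕ Fin N ⊕ Fin N → ℝ → ℝ := Sum.elim (fun n t => Y (n + 1) t - 1)
    (Sum.elim (fun n t => Y (n + 2) t - (2 / 3 + Y (n + 1) t / 2))
      (fun n t => c * (16 * Y (n + 1) t ^ 4 - 1) / 15 - Y (n + 2) t))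
  let f' : Fin N ⊕ Fin N ⊕ Fin N → ℝ → ℝ := Sum.elim (fun n t => Y' n t)
    (Sum.elim (fun n t => Y' (n + 1) t - Y' n t / 2)
      (fun n t => c * (64 / 15 * Y (n + 1) t ^ 3) * Y' n t - Y' (n + 1) t))
  have hregion : ∀ t ∈ Icc a b, ∀ i, f i t ≤ 0 := by
    refine forall_nonpos_of_deriv_neg (f' := f') ?_ ?_ ?_
    · rintro (n | n | n) t ht
      · exact (hder' n t ht).sub_const 1
      · exact (hder' (n + 1) t ht).sub (((hder' n t ht).div_const 2).const_add _)
      · refine (((((((hder' n t ht).pow 4).const_mul 16).sub_const 1).const_mul c).div_const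
          15).sub (hder' (n + 1) t ht)).congr_deriv ?_
        simp only [f', Sum.elim_inr]
        push_cast
        ring
    · have ha : ∀ n < N, 0 ≤ Y (n + 1) a ∧ Y (n + 1) a ≤ 1 / 2 := fun n h => by
        rw [hYa n h]; exact ⟨h0 _, h1 _⟩
      have ha' : ∀ n, Y (n + 1) a ≤ 3 / 5 := fun n => by
        rcases lt_or_ge n N with h | h
        · linarith [(ha n h).2]
        · rw [hYge n h]
      rintro (n | n | n)
      · simp only [f, Sum.elim_inl]
        linarith [ha' n]
      · simp only [f, Sum.elim_inl, Sum.elim_inr]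
        linarith [ha' (n + 1), ha n n.2]
      · simp only [f, Sum.elim_inr]
        have : Y (n + 1) a ^ 4 ≤ (1 / 2) ^ 4 := pow_le_pow_left₀ (ha n n.2).1 (ha n n.2).2 4
        have := hnn a (left_mem_Icc.2 hab) (n + 2)
        nlinarith
    · intro t ht hle
      have hle1 : ∀ n < N, Y (n + 1) t ≤ 1 := fun n h => by
        have := hle (Sum.inl ⟨n, h⟩)
        simp only [f, Sum.elim_inl] at this
        linarith
      have hle2 : ∀ n < N, Y (n + 2) t ≤ 2 / 3 + Y (n + 1) t / 2 := fun n h => by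
        have := hle (Sum.inr (Sum.inl ⟨n, h⟩))
        simp only [f, Sum.elim_inl, Sum.elim_inr] at this
        linarith
      have hle3 : ∀ n < N, c * (16 * Y (n + 1) t ^ 4 - 1) / 15 ≤ Y (n + 2) t := fun n h => by
        have := hle (Sum.inr (Sum.inr ⟨n, h⟩))
        simp only [f, Sum.elim_inr] at this
        linarith
      have hle1' : ∀ n, Y n t ≤ 1 := by
        rintro (_ | n)
        · rw [hY0]; norm_num
        rcases lt_or_ge n N with h | h
        · exact hle1 n h
        · rw [hYge n h]; norm_num
      have hproj : (fun k => max 0 (min 1 (Y k t))) = fun k => Y k t := funext fun k => by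
        rw [min_eq_right (hle1' k), max_eq_right (hnn t ht k)]
      have hY'lt : ∀ n < N, Y' n t = -(A * 4 ^ n) * Y (n + 1) t
          + B * L ^ n * (c * Y n t ^ 2 - Y (n + 1) t * Y (n + 2) t) := fun n h => by
        simp only [Y', h, if_true]
        rw [hproj]
        rfl
      have hAn : ∀ n : ℕ, 0 < A * 4 ^ n := fun n => by positivity
      have hBn : ∀ n : ℕ, 0 < B * L ^ n := fun n => by positivity
      have hsucc : ∀ n : ℕ, n + 1 < N → Y' (n + 1) t = -(4 * (A * 4 ^ n)) * Y (n + 2) t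
          + L * (B * L ^ n) * (c * Y (n + 1) t ^ 2 - Y (n + 2) t * Y (n + 3) t) := fun n h => by
        rw [hY'lt _ h]; ring
      rintro (⟨n, hn⟩ | ⟨n, hn⟩ | ⟨n, hn⟩) hi
      · simp only [f, f', Sum.elim_inl] at hi ⊢
        have hx : Y (n + 1) t = 1 := by linarith
        have hz := hle3 n hn
        rw [hY'lt n hn, hx]
        rw [hx] at hz
        have hp : Y n t ^ 2 ≤ 1 := pow_le_one₀ (hnn t ht n) (hle1' n)
        have : 0 ≤ B * L ^ n * (1 * Y (n + 2) t - c * Y n t ^ 2) :=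
          mul_nonneg (hBn n).le (by nlinarith)
        linarith [hAn n]
      · simp only [f, f', Sum.elim_inl, Sum.elim_inr] at hi ⊢
        rcases lt_or_ge (n + 1) N with h | h
        · have := upper_boundary (p := Y n t) (hAn n) (hBn n) hc hL0 hLc (hnn t ht (n + 1))
            (by linarith) (hle1' (n + 2)) (hle3 (n + 1) h)
          rw [hsucc n h, hY'lt n hn]
          linarith
        · have := hnn t ht (n + 1)
          rw [hYge (n + 1) h] at hi
          linarith
      · simp only [f, f', Sum.elim_inr] at hi ⊢
        rcases lt_or_ge (n + 1) N with h | h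
        · have := lower_boundary (hAn n) (hBn n) hc hc' hL (hnn t ht (n + 1)) (hle1' (n + 1))
            (by linarith) (hnn t ht (n + 2)) (hnn t ht n) (hle1' n) (hle2 (n + 1) h)
          rw [hsucc n h, hY'lt n hn]
          linarith
        · have : Y (n + 1) t ^ 4 ≤ 1 := pow_le_one₀ (hnn t ht _) (hle1' _)
          rw [hYge (n + 1) h] at hi
          nlinarith
  have hle : ∀ t ∈ Icc a b, ∀ n, Y n t ≤ 1 := by
    rintro t ht (_ | n)
    · rw [hY0]; norm_num
    rcases lt_or_ge n N with h | h
    · have := hregion t ht (Sum.inl ⟨n, h⟩)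
      simp only [f, Sum.elim_inl] at this
      linarith
    · rw [hYge n h]; norm_num
  refine ⟨Y, hY0, hYa, fun t ht n => ⟨hnn t ht n, hle t ht n⟩, fun n h t ht => ?_⟩
  have hproj : (fun k => max 0 (min 1 (Y k t))) = fun k => Y k t := funext fun k => by
    rw [min_eq_right (hle t ht k), max_eq_right (hnn t ht k)]
  simpa only [hproj] using hder n h t ht

lemma sum_weighted_diff_le {A B c L q : ℝ} (hA : 0 ≤ A) (hB : 0 ≤ B) (hL : 0 ≤ L) (hq : 0 ≤ q)
    (hqLc : q * L * c = 1) {v y : ℕ → ℝ} (hv : ∀ n, 0 ≤ v n) (hy : ∀ n, 0 ≤ y n)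
    (hv0 : v 0 = 0) (hy0 : y 0 = 0) (N : ℕ) :
    ∑ n ∈ Finset.range N, (q / 2) ^ n * (2 * (v (n + 1) - y (n + 1)) *
        (scaledField A B c L v n - scaledField A B c L y n))
      ≤ -(2 * c * B * (q / 2) ^ N * L ^ N * ((v N ^ 2 - y N ^ 2) * (v (N + 1) - y (N + 1)))) := by
  induction N with
  | zero => simp [hv0, hy0]
  | succ N ih =>
    rw [Finset.sum_range_succ]
    have h1 : 0 ≤ (q / 2) ^ N * (A * 4 ^ N) * (v (N + 1) - y (N + 1)) ^ 2 := by positivity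
    have h2 : 0 ≤ (q / 2) ^ N * (B * L ^ N) *
        ((v (N + 1) - y (N + 1)) ^ 2 * (v (N + 2) + y (N + 2))) := by
      have := add_nonneg (hv (N + 2)) (hy (N + 2))
      positivity
    have h3 : 2 * c * B * (q / 2) ^ (N + 1) * L ^ (N + 1) = B * (q / 2) ^ N * L ^ N := by
      calc _ = (q * L * c) * (B * (q / 2) ^ N * L ^ N) := by ring
        _ = _ := by rw [hqLc, one_mul]
    rw [h3]
    refine (add_le_add ih le_rfl).trans ?_
    simp only [scaledField]
    linarith

lemma sum_weighted_energy_eq {A B c L q : ℝ} (hqLc : q * L * c = 1) {v : ℕ → ℝ}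
    (hv0 : v 0 = 0) (N : ℕ) :
    ∑ n ∈ Finset.range N, q ^ n * (2 * v (n + 1) * scaledField A B c L v n)
      = -(2 * A * ∑ n ∈ Finset.range N, (4 * q) ^ n * v (n + 1) ^ 2)
        - 2 * c * B * q ^ N * L ^ N * (v N ^ 2 * v (N + 1)) := by
  induction N with
  | zero => simp [hv0]
  | succ N ih =>
    rw [Finset.sum_range_succ, Finset.sum_range_succ, ih]
    have h3 : 2 * c * B * q ^ (N + 1) * L ^ (N + 1) = 2 * B * q ^ N * L ^ N := by
      calc _ = (q * L * c) * (2 * B * q ^ N * L ^ N) := by ring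
        _ = _ := by rw [hqLc, one_mul]
    rw [h3, mul_pow]
    simp only [scaledField]
    ring

lemma boundary_term_le {L q u w : ℝ} (hL4 : L ≤ 4) (hq : 0 < q) (hL : 0 < L) (hw : 0 ≤ w)
    (M : ℕ) :
    (q * L / 2) ^ (M + 1) * (u ^ 2 + w) ≤ (q * L / 4) ^ (M + 1)
      + (1 + q * L) * (q * L) ^ M * (u ^ 2 + 4 * q * w ^ 2) := by
  have hx : 0 < q * L := by positivity
  have e1 : (q * L / 2) ^ (M + 1) * w
      ≤ (q * L / 4) ^ (M + 1) + (q * L) ^ (M + 1) * w ^ 2 := by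
    have e : w ≤ (1 / 2) ^ (M + 1) + 2 ^ (M + 1) * w ^ 2 := by
      have hs : (0 : ℝ) < 2 ^ (M + 1) := by positivity
      have hinv : ((1 : ℝ) / 2) ^ (M + 1) * 2 ^ (M + 1) = 1 := by
        rw [← mul_pow]; norm_num
      have hs' : (0 : ℝ) < (1 / 2) ^ (M + 1) := by positivity
      have : 0 ≤ (1 / 2 : ℝ) ^ (M + 1) * (2 ^ (M + 1) * w - 1) ^ 2 := by positivity
      nlinarith [hw]
    have := mul_le_mul_of_nonneg_left e (show 0 ≤ (q * L / 2) ^ (M + 1) by positivity)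
    have f1 : (q * L / 2) ^ (M + 1) * (1 / 2) ^ (M + 1) = (q * L / 4) ^ (M + 1) := by
      rw [← mul_pow]; congr 1; ring
    have f2 : (q * L / 2) ^ (M + 1) * 2 ^ (M + 1) = (q * L) ^ (M + 1) := by
      rw [← mul_pow]; congr 1; ring
    rwa [mul_add, ← mul_assoc, f1, f2] at this
  have e2 : (q * L / 2) ^ (M + 1) ≤ (1 + q * L) * (q * L) ^ M := by
    calc (q * L / 2) ^ (M + 1) ≤ (q * L) ^ (M + 1) := by gcongr; linarith
      _ ≤ _ := by rw [pow_succ]; nlinarith [pow_pos hx M]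
  have e3 : (q * L) ^ (M + 1) ≤ (1 + q * L) * (q * L) ^ M * (4 * q) := by
    have : q * L ≤ (1 + q * L) * (4 * q) := by nlinarith [mul_pos hx hq]
    calc (q * L) ^ (M + 1) = (q * L) ^ M * (q * L) := pow_succ _ _
      _ ≤ (q * L) ^ M * ((1 + q * L) * (4 * q)) := by gcongr
      _ = _ := by ring
  have e4 := mul_le_mul_of_nonneg_right e2 (sq_nonneg u)
  have e5 := mul_le_mul_of_nonneg_right e3 (sq_nonneg w)
  linarith

/-- Bound on the time derivative of the weighted distance between a solution and an approximation,
corrected by a small multiple of the energy. -/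
lemma weighted_distance_deriv_le {A B c L q : ℝ} (hA : 0 < A) (hB : 0 < B) (hc : 0 < c)
    (hL : 0 < L) (hL4 : L ≤ 4) (hq : 0 < q) (hqLc : q * L * c = 1) {v y : ℕ → ℝ}
    (hv : ∀ n, 0 ≤ v n) (hy : ∀ n, 0 ≤ y n) (hy1 : ∀ n, y n ≤ 1)
    (hv0 : v 0 = 0) (hy0 : y 0 = 0) (M : ℕ) :
    ∑ n ∈ Finset.range (M + 1), (q / 2) ^ n * (2 * (v (n + 1) - y (n + 1)) *
        (scaledField A B c L v n - scaledField A B c L y n))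
      + c * B / A * (1 + q * L) * (L / 4) ^ M *
        ∑ n ∈ Finset.range (M + 2), q ^ n * (2 * v (n + 1) * scaledField A B c L v n)
      ≤ 2 * c * B * (q * L / 4) ^ (M + 1) := by
  have h1 := sum_weighted_diff_le hA.le hB.le hL.le hq.le hqLc hv hy hv0 hy0 (M + 1)
  have h2 := sum_weighted_energy_eq (A := A) (B := B) hqLc hv0 (M + 2)
  have h3 : (4 * q) ^ M * v (M + 1) ^ 2 + (4 * q) ^ (M + 1) * v (M + 2) ^ 2
      ≤ ∑ n ∈ Finset.range (M + 2), (4 * q) ^ n * v (n + 1) ^ 2 := by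
    rw [Finset.sum_range_succ, Finset.sum_range_succ]
    have : 0 ≤ ∑ n ∈ Finset.range M, (4 * q) ^ n * v (n + 1) ^ 2 :=
      Finset.sum_nonneg fun n _ => by positivity
    linarith
  have h4 : ∑ n ∈ Finset.range (M + 2), q ^ n * (2 * v (n + 1) * scaledField A B c L v n)
      ≤ -(2 * A * ((4 * q) ^ M * v (M + 1) ^ 2 + (4 * q) ^ (M + 1) * v (M + 2) ^ 2)) := by
    have : 0 ≤ 2 * c * B * q ^ (M + 2) * L ^ (M + 2) * (v (M + 2) ^ 2 * v (M + 2 + 1)) := by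
      have := hv (M + 2 + 1)
      positivity
    nlinarith
  have h5 := mul_le_mul_of_nonneg_left h4
    (show 0 ≤ c * B / A * (1 + q * L) * (L / 4) ^ M by positivity)
  have h6 : c * B / A * (1 + q * L) * (L / 4) ^ M *
      -(2 * A * ((4 * q) ^ M * v (M + 1) ^ 2 + (4 * q) ^ (M + 1) * v (M + 2) ^ 2))
      = -(2 * c * B * ((1 + q * L) * (q * L) ^ M * (v (M + 1) ^ 2 + 4 * q * v (M + 2) ^ 2))) := by
    have : (L / 4) ^ M * (4 * q) ^ M = (q * L) ^ M := by
      rw [← mul_pow]; congr 1; ring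
    rw [← this]
    field_simp
    ring
  have h7 : -(2 * c * B * (q / 2) ^ (M + 1) * L ^ (M + 1) *
      ((v (M + 1) ^ 2 - y (M + 1) ^ 2) * (v (M + 1 + 1) - y (M + 1 + 1))))
      ≤ 2 * c * B * ((q * L / 2) ^ (M + 1) * (v (M + 1) ^ 2 + v (M + 2))) := by
    have e : (q * L / 2) ^ (M + 1) = (q / 2) ^ (M + 1) * L ^ (M + 1) := by
      rw [← mul_pow]; congr 1; ring
    have e2 : -((v (M + 1) ^ 2 - y (M + 1) ^ 2) * (v (M + 2) - y (M + 2)))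
        ≤ v (M + 1) ^ 2 + v (M + 2) := by
      have g1 := mul_le_mul_of_nonneg_left (hy1 (M + 2)) (sq_nonneg (v (M + 1)))
      have g2 : y (M + 1) ^ 2 * v (M + 2) ≤ 1 * v (M + 2) :=
        mul_le_mul_of_nonneg_right (pow_le_one₀ (hy _) (hy1 _)) (hv _)
      have g3 := mul_nonneg (sq_nonneg (v (M + 1))) (hv (M + 2))
      have g4 := mul_nonneg (sq_nonneg (y (M + 1))) (hy (M + 2))
      linarith
    have e3 := mul_le_mul_of_nonneg_left e2
      (show 0 ≤ 2 * c * B * (q / 2) ^ (M + 1) * L ^ (M + 1) by positivity)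
    rw [e]
    linarith
  have h8 := boundary_term_le hL4 hq hL (hv (M + 2)) (u := v (M + 1)) M
  have h9 := mul_le_mul_of_nonneg_left h8 (show 0 ≤ 2 * c * B by positivity)
  linarith

/-- The rescaled model preserves the bound `1` for solutions starting below `1 / 2`. -/
lemma scaled_solution_le_one {A B c L : ℝ} (hA : 0 < A) (hB : 0 < B) (hc : 1 / 4 < c)
    (hc' : c ≤ 103 / 200) (hL : 99 / 25 ≤ L) (hL4 : L < 4) (hLc : 1 ≤ L * c) {a : ℝ}
    {V : ℕ → ℝ → ℝ} (hV0 : ∀ t, V 0 t = 0) (hV : ∀ n, ∀ t ∈ Ici a, 0 ≤ V n t)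
    (hVa : ∀ n, V n a ≤ 1 / 2)
    (hd : ∀ n, ∀ t ∈ Ici a,
      HasDerivWithinAt (V (n + 1)) (scaledField A B c L (fun k => V k t) n) (Ici a) t)
    {t : ℝ} (ht : t ∈ Ici a) (n : ℕ) : V n t ≤ 1 := by
  have hc0 : 0 < c := by linarith
  have hL0 : 0 < L := by linarith
  rcases n with _ | n
  · rw [hV0]; norm_num
  set q : ℝ := 1 / (L * c) with hq
  have hq0 : 0 < q := by positivity
  have hq1 : q ≤ 1 := by rw [hq, div_le_one (by positivity)]; exact hLc
  have hqLc : q * L * c = 1 := by rw [hq]; field_simp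
  set C : ℝ := c * B / A * (1 + q * L) with hC
  have hC0 : 0 < C := by positivity
  by_contra! hgt
  have key : ∀ M : ℕ, n ≤ M → (q / 2) ^ n * (V (n + 1) t - 1) ^ 2
      ≤ C * (L / 4) ^ M * (M + 2) + 2 * c * B * (q * L / 4) ^ (M + 1) * (t - a) := by
    intro M hM
    obtain ⟨Y, hY0, hYa, hY01, hYd⟩ := exists_galerkin hA hB hc0 hc' hL hLc (M + 1)
      (v₀ := fun k => V k a) (fun k => hV k a self_mem_Ici) hVa (show a ≤ t from ht)
    have hVd : ∀ k, ∀ s ∈ Icc a t, HasDerivWithinAt (V (k + 1))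
        (scaledField A B c L (fun k => V k s) k) (Icc a t) s := fun k s hs =>
      (hd k s hs.1).mono Icc_subset_Ici_self
    let G : ℝ → ℝ := fun s =>
      ∑ k ∈ Finset.range (M + 1), (q / 2) ^ k * (V (k + 1) s - Y (k + 1) s) ^ 2
        + C * (L / 4) ^ M * ∑ k ∈ Finset.range (M + 2), q ^ k * V (k + 1) s ^ 2
    let G' : ℝ → ℝ := fun s =>
      ∑ k ∈ Finset.range (M + 1), (q / 2) ^ k * (2 * (V (k + 1) s - Y (k + 1) s) *
          (scaledField A B c L (fun k => V k s) k - scaledField A B c L (fun k => Y k s) k))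
        + C * (L / 4) ^ M * ∑ k ∈ Finset.range (M + 2),
          q ^ k * (2 * V (k + 1) s * scaledField A B c L (fun k => V k s) k)
    have hG : ∀ s ∈ Icc a t, HasDerivWithinAt G (G' s) (Icc a t) s := by
      intro s hs
      refine HasDerivWithinAt.add ?_ (HasDerivWithinAt.const_mul _ ?_)
      · refine HasDerivWithinAt.fun_sum fun k hk => HasDerivWithinAt.const_mul _ ?_
        refine (((hVd k s hs).sub (hYd k (Finset.mem_range.1 hk) s hs)).pow 2).congr_deriv ?_
        simp
      · refine HasDerivWithinAt.fun_sum fun k _ => HasDerivWithinAt.const_mul _ ?_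
        refine ((hVd k s hs).pow 2).congr_deriv ?_
        simp
    have hGle : G t ≤ C * (L / 4) ^ M * (M + 2)
        + 2 * c * B * (q * L / 4) ^ (M + 1) * (t - a) := by
      refine image_le_of_deriv_right_le_deriv_boundary (f := G) (f' := G') (a := a) (b := t)
        (B := fun s => C * (L / 4) ^ M * (M + 2)
          + 2 * c * B * (q * L / 4) ^ (M + 1) * (s - a))
        (B' := fun _ => 2 * c * B * (q * L / 4) ^ (M + 1))
        (fun s hs => (hG s hs).continuousWithinAt)
        (fun s hs => hasDerivWithinAt_Ici_of_Icc hs (hG s (Ico_subset_Icc_self hs)))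
        ?_ (by fun_prop) ?_ ?_ (right_mem_Icc.2 ht)
      · have e1 : ∑ k ∈ Finset.range (M + 1), (q / 2) ^ k * (V (k + 1) a - Y (k + 1) a) ^ 2
            = 0 := by
          refine Finset.sum_eq_zero fun k hk => ?_
          rw [hYa k (Finset.mem_range.1 hk)]
          simp
        have e2 : ∑ k ∈ Finset.range (M + 2), q ^ k * V (k + 1) a ^ 2 ≤ M + 2 := by
          calc _ ≤ ∑ k ∈ Finset.range (M + 2), (1 : ℝ) := by
                refine Finset.sum_le_sum fun k _ => ?_
                have h1 : q ^ k ≤ 1 := pow_le_one₀ hq0.le hq1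
                have h2 : V (k + 1) a ^ 2 ≤ 1 :=
                  pow_le_one₀ (hV _ a self_mem_Ici) (by linarith [hVa (k + 1)])
                exact mul_le_one₀ h1 (sq_nonneg _) h2
            _ = M + 2 := by simp
        simp only [G, e1, sub_self, mul_zero, zero_add, add_zero]
        exact mul_le_mul_of_nonneg_left e2 (by positivity)
      · intro s _
        simpa using ((((hasDerivAt_id s).sub_const a).const_mul
          (2 * c * B * (q * L / 4) ^ (M + 1))).const_add
            (C * (L / 4) ^ M * ((M : ℝ) + 2))).hasDerivWithinAt
      · intro s hs
        have hs' := Ico_subset_Icc_self hs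
        exact weighted_distance_deriv_le hA hB hc0 hL0 hL4.le hq0 hqLc
          (fun k => hV k s hs.1) (fun k => (hY01 s hs' k).1) (fun k => (hY01 s hs' k).2)
          (hV0 s) (hY0 s) M
    have hYt := (hY01 t (right_mem_Icc.2 ht) (n + 1)).2
    calc (q / 2) ^ n * (V (n + 1) t - 1) ^ 2
        ≤ (q / 2) ^ n * (V (n + 1) t - Y (n + 1) t) ^ 2 := by
          have : 0 ≤ V (n + 1) t - 1 := by linarith
          gcongr
      _ ≤ ∑ k ∈ Finset.range (M + 1), (q / 2) ^ k * (V (k + 1) t - Y (k + 1) t) ^ 2 :=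
          Finset.single_le_sum (f := fun k => (q / 2) ^ k * (V (k + 1) t - Y (k + 1) t) ^ 2)
            (fun k _ => by positivity) (Finset.mem_range.2 (by omega))
      _ ≤ G t := le_add_of_nonneg_right
          (mul_nonneg (by positivity) (Finset.sum_nonneg fun k _ => by positivity))
      _ ≤ _ := hGle
  have hlim : Tendsto (fun M : ℕ => C * (L / 4) ^ M * (M + 2)
      + 2 * c * B * (q * L / 4) ^ (M + 1) * (t - a)) atTop (𝓝 0) := by
    have hr : L / 4 < 1 := by linarith
    have hr0 : 0 ≤ L / 4 := by positivity
    have hqL : q * L / 4 < 1 := by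
      have : q * L = 1 / c := by rw [hq]; field_simp
      rw [this, div_div, div_lt_one (by positivity)]
      linarith
    have t1 := tendsto_self_mul_const_pow_of_lt_one hr0 hr
    have t2 := tendsto_pow_atTop_nhds_zero_of_lt_one hr0 hr
    have t3 := (tendsto_add_atTop_iff_nat 1).2
      (tendsto_pow_atTop_nhds_zero_of_lt_one (by positivity) hqL)
    have := ((t1.add (t2.const_mul 2)).const_mul C).add
      ((t3.const_mul (2 * c * B)).mul_const (t - a))
    simp only [mul_zero, add_zero, zero_mul] at this
    refine this.congr fun M => ?_
    ring
  have hpos : 0 < (q / 2) ^ n * (V (n + 1) t - 1) ^ 2 := by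
    have : 0 < V (n + 1) t - 1 := by linarith
    positivity
  obtain ⟨M, hM, hnM⟩ := ((hlim.eventually (gt_mem_nhds hpos)).and (eventually_ge_atTop n)).exists
  exact absurd (key M hnM) (not_le.2 hM)

lemma lam_succ_rpow (n : ℕ) (s : ℝ) : lam (n + 1) ^ s = ((2 : ℝ) ^ s) ^ (n + 1) := by
  rw [lam, if_neg n.succ_ne_zero, ← Real.rpow_natCast_mul (by norm_num),
    ← Real.rpow_mul_natCast (by norm_num), mul_comm]

lemma lam_zero_rpow {s : ℝ} (hs : s ≠ 0) : lam 0 ^ s = 0 := by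
  rw [lam, if_pos rfl, Real.zero_rpow hs]

lemma two_rpow_le_one_add {s : ℝ} (h0 : 0 ≤ s) (h1 : s ≤ 1) : (2 : ℝ) ^ s ≤ 1 + s := by
  have := rpow_one_add_le_one_add_mul_self (s := 1) (by norm_num) h0 h1
  norm_num at this
  linarith

/-- Rescaling by `lam n ^ α / K` turns the viscous model into the system with right-hand side
`scaledField`. -/
lemma IsViscousSolution.hasDerivWithinAt_rescaled {β ν α K : ℝ} {I : Set ℝ} {X : ℕ → ℝ → ℝ}
    (hX : IsViscousSolution β ν I X) (hβ : β ≠ 0) (hα : α ≠ 0) (hK : 0 < K) (n : ℕ)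
    {t : ℝ} (ht : t ∈ I) :
    HasDerivWithinAt (fun s => lam (n + 1) ^ α * X (n + 1) s / K)
      (scaledField (4 * ν) (K * (2 ^ β / 2 ^ α) / 2 ^ α) ((2 ^ α) ^ 3 / 2 ^ β) (2 ^ β / 2 ^ α)
        (fun k => lam k ^ α * X k t / K) n) I t := by
  refine (((hX (n + 1) (by omega) t ht).const_mul (lam (n + 1) ^ α)).div_const K).congr_deriv ?_
  have hP : (0 : ℝ) < 2 ^ β := by positivity
  have hR : (0 : ℝ) < 2 ^ α := by positivity
  have hsq : lam (n + 1) ^ 2 = 4 * 4 ^ n := by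
    rw [lam, if_neg n.succ_ne_zero, ← pow_mul, mul_comm, pow_mul, pow_succ']
    norm_num
  simp only [scaledField, hsq, add_tsub_cancel_right]
  rw [lam_succ_rpow n, lam_succ_rpow n, lam_succ_rpow (n + 1)]
  rcases n with _ | n
  · rw [lam_zero_rpow hβ, lam_zero_rpow hα]
    field_simp
    ring
  · rw [lam_succ_rpow n, lam_succ_rpow n, div_pow]
    field_simp
    ring

lemma scaling_bound_of_pos {β ν t₀ K : ℝ} {X : ℕ → ℝ → ℝ} (hβ : 2 < β) (hβ' : β ≤ 5 / 2)
    (hν : 0 < ν) (hX : IsViscousSolution β ν (Ici t₀) X)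
    (hnn : ∀ n, 1 ≤ n → ∀ t ∈ Ici t₀, 0 ≤ X n t) (hK : 0 < K)
    (h₀ : ∀ n, 1 ≤ n → lam n ^ (β - 2 + 1 / 100) * X n t₀ ≤ K / 2) {t : ℝ} (ht : t ∈ Ici t₀)
    (n : ℕ) : lam n ^ (β - 2 + 1 / 100) * X n t ≤ K := by
  set α : ℝ := β - 2 + 1 / 100 with hα
  have h2 : (0 : ℝ) < 2 := by norm_num
  have hα0 : α ≠ 0 := by linarith
  have hLeq : (2 : ℝ) ^ β / 2 ^ α = 4 / 2 ^ (1 / 100 : ℝ) := by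
    rw [← Real.rpow_sub h2, show β - α = 2 - 1 / 100 by rw [hα]; ring, Real.rpow_sub h2]
    norm_num
  have hceq : ((2 : ℝ) ^ α) ^ 3 / 2 ^ β = 2 ^ (2 * β - 6 + 3 / 100) := by
    rw [← Real.rpow_mul_natCast h2.le, ← Real.rpow_sub h2]
    congr 1
    rw [hα]; push_cast; ring
  have hQ : (2 : ℝ) ^ (1 / 100 : ℝ) ≤ 1 + 1 / 100 :=
    two_rpow_le_one_add (by norm_num) (by norm_num)
  have hQ1 : 1 < (2 : ℝ) ^ (1 / 100 : ℝ) := Real.one_lt_rpow (by norm_num) (by norm_num)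
  have hc : 1 / 4 < ((2 : ℝ) ^ α) ^ 3 / 2 ^ β := by
    rw [hceq]
    calc (1 / 4 : ℝ) = 2 ^ (-2 : ℝ) := by norm_num [Real.rpow_neg]
      _ < _ := Real.rpow_lt_rpow_of_exponent_lt (by norm_num) (by linarith)
  have hc' : ((2 : ℝ) ^ α) ^ 3 / 2 ^ β ≤ 103 / 200 := by
    rw [hceq]
    calc (2 : ℝ) ^ (2 * β - 6 + 3 / 100) ≤ 2 ^ ((3 / 100 : ℝ) - 1) :=
          Real.rpow_le_rpow_of_exponent_le (by norm_num) (by linarith)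
      _ = 2 ^ (3 / 100 : ℝ) / 2 := by rw [Real.rpow_sub h2, Real.rpow_one]
      _ ≤ (1 + 3 / 100) / 2 := by
          gcongr
          exact two_rpow_le_one_add (by norm_num) (by norm_num)
      _ = 103 / 200 := by norm_num
  have hL : 99 / 25 ≤ (2 : ℝ) ^ β / 2 ^ α := by
    rw [hLeq, le_div_iff₀ (by positivity)]
    linarith
  have hL4 : (2 : ℝ) ^ β / 2 ^ α < 4 := by
    rw [hLeq, div_lt_iff₀ (by positivity)]
    linarith
  have hLc : 1 ≤ (2 : ℝ) ^ β / 2 ^ α * ((2 ^ α) ^ 3 / 2 ^ β) := by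
    have : (2 : ℝ) ^ β / 2 ^ α * ((2 ^ α) ^ 3 / 2 ^ β) = (2 ^ α) ^ 2 := by
      field_simp
    rw [this]
    exact one_le_pow₀ (Real.one_le_rpow (by norm_num) (by linarith))
  have hlam : ∀ k, 0 ≤ lam k ^ α := fun k => by
    rcases k with _ | k
    · rw [lam_zero_rpow hα0]
    · rw [lam_succ_rpow]; positivity
  have hV0 : ∀ s, lam 0 ^ α * X 0 s / K = 0 := fun s => by
    rw [lam_zero_rpow hα0, zero_mul, zero_div]
  have := scaled_solution_le_one (V := fun k s => lam k ^ α * X k s / K)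
    (show 0 < 4 * ν by linarith) (by positivity) hc hc' hL hL4 hLc hV0
    (fun k s hs => by
      rcases k with _ | k
      · exact (hV0 s).ge
      · have := hnn (k + 1) (by omega) s hs
        have := hlam (k + 1)
        positivity)
    (fun k => by
      rcases k with _ | k
      · rw [hV0]; norm_num
      · rw [div_le_iff₀ hK]
        linarith [h₀ (k + 1) (by omega)])
    (fun k s hs => hX.hasDerivWithinAt_rescaled (by linarith) hα0 hK k hs) ht n
  rwa [div_le_one hK] at this

/-- there are `ε > 0` and `δ ∈ (0,1)` such that for every
`β ∈ (2, 5/2]`, `ν > 0`, `t₀ ≥ 0` and every nonnegative square-summable weak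
solution on `[t₀,∞)` whose initial data are bounded by `K₀` in the
`λ_n^{β-2+ε}` scaling, the solution stays bounded by `K₀/δ` in the same scaling
for all `t ≥ t₀`. -/
theorem uniform_scaling_bound :
    ∃ ε : ℝ, 0 < ε ∧ ∃ δ ∈ Set.Ioo (0 : ℝ) 1,
      ∀ β : ℝ, 2 < β → β ≤ 5 / 2 → ∀ ν : ℝ, 0 < ν → ∀ t₀ : ℝ, 0 ≤ t₀ →
      ∀ X : ℕ → ℝ → ℝ, IsViscousSolution β ν (Set.Ici t₀) X →
        (∀ n, 1 ≤ n → ∀ t ∈ Set.Ici t₀, 0 ≤ X n t) →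
        (Summable fun n => X (n + 1) t₀ ^ 2) →
      ∀ K₀ : ℝ, (∀ n, 1 ≤ n → lam n ^ (β - 2 + ε) * X n t₀ ≤ K₀) →
      ∀ t ∈ Set.Ici t₀, ∀ n, 1 ≤ n → lam n ^ (β - 2 + ε) * X n t ≤ K₀ / δ := by
  refine ⟨1 / 100, by norm_num, 1 / 2, ⟨by norm_num, by norm_num⟩, ?_⟩
  intro β hβ hβ' ν hν t₀ _ X hX hnn _ K₀ hK₀ t ht n _
  have hK₀_nonneg : 0 ≤ K₀ := by
    refine le_trans (mul_nonneg ?_ (hnn 1 le_rfl t₀ self_mem_Ici)) (hK₀ 1 le_rfl)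
    rw [lam_succ_rpow]
    positivity
  refine le_of_forall_pos_le_add fun η hη => ?_
  have := scaling_bound_of_pos (K := 2 * K₀ + η) hβ hβ' hν hX hnn (by linarith)
    (fun k hk => (hK₀ k hk).trans (by linarith)) ht n
  linarith
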